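/- Let n ≥ 5 and let v ∈ C⁴(ℝ) be a positive solution of equation (∗). Suppose θ ∈ [0, +∞] is such that v(t) → θ as t → +∞, or v(t) → θ as t → -∞. Then θ ∈ {0, K₀^{(n-4)/8}}; in particular, θ is finite and v cannot tend to +∞. -/

import Mathlib

open Filter Topology

/-- A function whose derivative is eventually bounded below by a positive constant
tends to `+∞`. -/
lemma tendsto_atTop_of_eventually_le_hasDerivAt {f f' : ℝ → ℝ} (hf : ∀ t, HasDerivAt f (f' t) t)
    {c : ℝ} (hc : 0 < c) (h : ∀ᶠ t in atTop, c ≤ f' t) : Tendsto f atTop atTop := by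
  obtain ⟨T, hT⟩ := eventually_atTop.1 h
  have key : ∀ t, T ≤ t → f T + c * (t - T) ≤ f t := by
    intro t ht
    have := Convex.mul_sub_le_image_sub_of_le_deriv (convex_Ici T)
      (fun x _ => (hf x).continuousAt.continuousWithinAt)
      (fun x _ => (hf x).differentiableAt.differentiableWithinAt)
      (C := c) (fun x hx => by
        rw [(hf x).deriv]
        exact hT x (interior_subset hx)) T Set.self_mem_Ici t ht ht
    linarith
  refine tendsto_atTop_mono' atTop (f₁ := fun t => f T + c * (t - T)) ?_ ?_
  · filter_upwards [eventually_ge_atTop T] with t ht using key t ht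
  · exact tendsto_atTop_add_const_left _ _
      (Tendsto.const_mul_atTop hc (tendsto_atTop_add_const_right _ _ tendsto_id))

lemma tendsto_atTop_of_tendsto_hasDerivAt {f f' : ℝ → ℝ} (hf : ∀ t, HasDerivAt f (f' t) t)
    (h : Tendsto f' atTop atTop) : Tendsto f atTop atTop :=
  tendsto_atTop_of_eventually_le_hasDerivAt hf one_pos (h.eventually_ge_atTop 1)

/-- A function bounded below for which `g'''' - k g''` is eventually at least a positive constant
tends to `+∞` together with its first three derivatives. -/
lemma tendsto_atTop_of_fourth_order_lower_bound {g g₁ g₂ g₃ g₄ : ℝ → ℝ} {k c m : ℝ}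
    (h₁ : ∀ t, HasDerivAt g (g₁ t) t) (h₂ : ∀ t, HasDerivAt g₁ (g₂ t) t)
    (h₃ : ∀ t, HasDerivAt g₂ (g₃ t) t) (h₄ : ∀ t, HasDerivAt g₃ (g₄ t) t)
    (hk : 0 < k) (hc : 0 < c) (hm : ∀ᶠ t in atTop, m ≤ g t)
    (h : ∀ᶠ t in atTop, c ≤ g₄ t - k * g₂ t) :
    Tendsto g atTop atTop ∧ Tendsto g₁ atTop atTop ∧ Tendsto g₂ atTop atTop ∧
      Tendsto g₃ atTop atTop := by
  have hw₁ : Tendsto (fun t => g₃ t - k * g₁ t) atTop atTop :=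
    tendsto_atTop_of_eventually_le_hasDerivAt (fun t => (h₄ t).sub ((h₂ t).const_mul k)) hc h
  have hw : Tendsto (fun t => g₂ t - k * g t) atTop atTop :=
    tendsto_atTop_of_tendsto_hasDerivAt (fun t => (h₃ t).sub ((h₁ t).const_mul k)) hw₁
  have hg₂ : Tendsto g₂ atTop atTop := by
    refine tendsto_atTop_mono' atTop ?_ (tendsto_atTop_add_const_right _ (k * m) hw)
    filter_upwards [hm] with t ht
    nlinarith [mul_le_mul_of_nonneg_left ht hk.le]
  have hg₁ := tendsto_atTop_of_tendsto_hasDerivAt h₂ hg₂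
  have hg := tendsto_atTop_of_tendsto_hasDerivAt h₁ hg₁
  refine ⟨hg, hg₁, hg₂, ?_⟩
  refine tendsto_atTop_mono' atTop ?_ hw₁
  filter_upwards [hg₁.eventually_ge_atTop 0] with t ht
  nlinarith [mul_nonneg hk.le ht]

/-- Integrating `F' ≥ c v^q v'` when `v → +∞`. -/
lemma exists_eventually_rpow_le_of_hasDerivAt {F F' v v₁ : ℝ → ℝ} {c q : ℝ} (hq : 0 < q)
    (hc : 0 < c) (hF : ∀ t, HasDerivAt F (F' t) t) (hv : ∀ t, HasDerivAt v (v₁ t) t)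
    (hpos : ∀ t, 0 < v t) (hlim : Tendsto v atTop atTop)
    (h : ∀ᶠ t in atTop, c * v t ^ q * v₁ t ≤ F' t) :
    ∃ d > 0, ∀ᶠ t in atTop, d * v t ^ (q + 1) ≤ F t := by
  obtain ⟨T, hT⟩ := eventually_atTop.1 h
  have hq1 : 0 < q + 1 := by linarith
  set e := c / (q + 1) with he
  have hepos : 0 < e := by positivity
  have hG : ∀ t, HasDerivAt (fun t => F t - e * v t ^ (q + 1)) (F' t - c * v t ^ q * v₁ t) t := by
    intro t
    have := (hF t).sub (((hv t).rpow_const (p := q + 1) (Or.inl (hpos t).ne')).const_mul e)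
    refine this.congr_deriv ?_
    rw [add_sub_cancel_right, he]
    field_simp
  have hmono : MonotoneOn (fun t => F t - e * v t ^ (q + 1)) (Set.Ici T) := by
    refine monotoneOn_of_deriv_nonneg (convex_Ici T)
      (fun x _ => (hG x).continuousAt.continuousWithinAt)
      (fun x _ => (hG x).differentiableAt.differentiableWithinAt) (fun x hx => ?_)
    rw [(hG x).deriv]
    have := hT x (interior_subset hx)
    linarith
  refine ⟨e / 2, by positivity, ?_⟩
  have hbig : Tendsto (fun t => e / 2 * v t ^ (q + 1)) atTop atTop :=
    ((tendsto_rpow_atTop hq1).comp hlim).const_mul_atTop (by positivity)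
  filter_upwards [eventually_ge_atTop T,
    hbig.eventually_ge_atTop (-(F T - e * v T ^ (q + 1)))] with t ht hb
  have := hmono Set.self_mem_Ici ht ht
  simp only at this
  linarith

/-- No positive function on a half-line satisfying `v' ≥ c v^(1+s)` with `s, c > 0`. -/
lemma not_eventually_rpow_le_hasDerivAt {v v₁ : ℝ → ℝ} {c s : ℝ} (hs : 0 < s) (hc : 0 < c)
    (hv : ∀ t, HasDerivAt v (v₁ t) t) (hpos : ∀ t, 0 < v t) :
    ¬ ∀ᶠ t in atTop, c * v t ^ (s + 1) ≤ v₁ t := by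
  intro h
  have hd : ∀ t, HasDerivAt (fun t => -(v t ^ (-s))) (-(v₁ t * (-s) * v t ^ (-s - 1))) t :=
    fun t => ((hv t).rpow_const (Or.inl (hpos t).ne')).neg
  have hlim := tendsto_atTop_of_eventually_le_hasDerivAt hd (c := s * c) (by positivity) (by
    filter_upwards [h] with t ht
    have h1 : v t ^ (s + 1) * v t ^ (-s - 1) = 1 := by
      rw [← Real.rpow_add (hpos t)]
      ring_nf
      exact Real.rpow_zero _
    have h2 : 0 < v t ^ (-s - 1) := Real.rpow_pos_of_pos (hpos t) _
    calc s * c = s * (c * v t ^ (s + 1)) * v t ^ (-s - 1) := by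
          linear_combination (-(s * c)) * h1
      _ ≤ s * v₁ t * v t ^ (-s - 1) := by gcongr
      _ = _ := by ring)
  obtain ⟨t, ht⟩ := (hlim.eventually_ge_atTop 0).exists
  have := Real.rpow_pos_of_pos (hpos t) (-s)
  linarith

/-- A positive global solution of `v'''' - k v'' + K v = v^p` with `p > 1` does not
tend to `+∞`. -/
lemma not_tendsto_atTop_of_fourth_order_eq {v v₁ v₂ v₃ v₄ : ℝ → ℝ} {k K p : ℝ}
    (h₁ : ∀ t, HasDerivAt v (v₁ t) t) (h₂ : ∀ t, HasDerivAt v₁ (v₂ t) t)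
    (h₃ : ∀ t, HasDerivAt v₂ (v₃ t) t) (h₄ : ∀ t, HasDerivAt v₃ (v₄ t) t)
    (hk : 0 < k) (hp : 1 < p) (hpos : ∀ t, 0 < v t)
    (heq : ∀ t, v₄ t - k * v₂ t + K * v t = v t ^ p) : ¬ Tendsto v atTop atTop := by
  intro hlim
  have hhalf : ∀ᶠ t in atTop, 1 / 2 * v t ^ p ≤ v₄ t - k * v₂ t := by
    filter_upwards [((tendsto_rpow_atTop (sub_pos.2 hp)).comp hlim).eventually_ge_atTop (2 * K)]
      with t ht
    have h1 : v t ^ p = v t ^ (p - 1) * v t := by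
      rw [← Real.rpow_add_one (hpos t).ne', sub_add_cancel]
    have h2 := mul_le_mul_of_nonneg_right ht (hpos t).le
    simp only [Function.comp_apply] at h2
    linarith [heq t]
  have hbig : ∀ᶠ t in atTop, 1 ≤ v₄ t - k * v₂ t := by
    filter_upwards [hhalf, ((tendsto_rpow_atTop (zero_lt_one.trans hp)).comp
      hlim).eventually_ge_atTop 2] with t h ht
    simp only [Function.comp_apply] at ht
    linarith
  obtain ⟨-, l₁, l₂, l₃⟩ := tendsto_atTop_of_fourth_order_lower_bound h₁ h₂ h₃ h₄ hk one_pos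
    (Eventually.of_forall fun t => (hpos t).le) hbig
  have e₁ := l₁.eventually_ge_atTop 0
  have e₂ := l₂.eventually_ge_atTop 0
  have e₃ := l₃.eventually_ge_atTop 0
  obtain ⟨c, hc, hc'⟩ := exists_eventually_rpow_le_of_hasDerivAt (q := p) (by linarith)
    (one_half_pos (α := ℝ)) (fun t => (h₄ t).mul (h₂ t)) h₁ hpos hlim (by
      filter_upwards [hhalf, e₁, e₂, e₃] with t h a b d
      have : 1 / 2 * v t ^ p ≤ v₄ t := by nlinarith [mul_nonneg hk.le b]
      nlinarith [mul_le_mul_of_nonneg_right this a, mul_nonneg d b])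
  obtain ⟨d, hd, hd'⟩ := exists_eventually_rpow_le_of_hasDerivAt (q := p + 1) (by linarith)
    hc (fun t => (h₃ t).mul ((h₂ t).pow 2)) h₁ hpos hlim (by
      filter_upwards [hc', e₁, e₂] with t h a b
      simp only [Pi.mul_apply] at h
      have h1 := mul_le_mul_of_nonneg_right h a
      have h2 : 0 ≤ v₂ t * (v₁ t * v₂ t) := by positivity
      simp only [Pi.pow_apply]
      norm_num
      nlinarith)
  obtain ⟨e, he, he'⟩ := exists_eventually_rpow_le_of_hasDerivAt (q := p + 1 + 1) (by linarith)
    hd (fun t => (h₂ t).pow 4) h₁ hpos hlim (by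
      filter_upwards [hd', e₁, e₂] with t h a b
      simp only [Pi.mul_apply, Pi.pow_apply] at h
      have h1 := mul_le_mul_of_nonneg_right h a
      have h2 : 0 ≤ v₂ t * v₁ t ^ 3 := by positivity
      norm_num
      nlinarith)
  refine not_eventually_rpow_le_hasDerivAt (s := (p - 1) / 4) (c := e ^ (1 / 4 : ℝ))
    (by linarith) (by positivity) h₁ hpos ?_
  filter_upwards [he', e₁] with t h a
  simp only [Pi.pow_apply] at h
  have hv := hpos t
  refine le_of_pow_le_pow_left₀ (n := 4) (by norm_num) a ?_
  refine le_of_eq_of_le ?_ h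
  rw [mul_pow, ← Real.rpow_natCast, ← Real.rpow_natCast, ← Real.rpow_mul he.le,
    ← Real.rpow_mul hv.le]
  congr 1
  · norm_num
  · congr 1
    push_cast
    ring

/-- A finite limit of a positive solution of `v'''' - k v'' + K v = v^p` is a
constant solution. -/
lemma rpow_eq_mul_of_fourth_order_eq_of_tendsto {v v₁ v₂ v₃ v₄ : ℝ → ℝ} {k K p θ : ℝ}
    (h₁ : ∀ t, HasDerivAt v (v₁ t) t) (h₂ : ∀ t, HasDerivAt v₁ (v₂ t) t)
    (h₃ : ∀ t, HasDerivAt v₂ (v₃ t) t) (h₄ : ∀ t, HasDerivAt v₃ (v₄ t) t)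
    (hk : 0 < k) (hp : 0 < p)
    (heq : ∀ t, v₄ t - k * v₂ t + K * v t = v t ^ p) (hlim : Tendsto v atTop (𝓝 θ)) :
    θ ^ p = K * θ := by
  have hL : Tendsto (fun t => v₄ t - k * v₂ t) atTop (𝓝 (θ ^ p - K * θ)) := by
    refine ((hlim.rpow_const (Or.inr hp.le)).sub (hlim.const_mul K)).congr fun t => ?_
    linarith [heq t]
  rcases lt_trichotomy (θ ^ p - K * θ) 0 with h | h | h
  · have hb : ∀ᶠ t in atTop, -(θ ^ p - K * θ) / 2 ≤ -v₄ t - k * -v₂ t := by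
      filter_upwards [hL.eventually_le_const (show _ < (θ ^ p - K * θ) / 2 by linarith)] with t ht
      linarith
    have := (tendsto_atTop_of_fourth_order_lower_bound (m := -θ - 1) (fun t => (h₁ t).neg)
      (fun t => (h₂ t).neg) (fun t => (h₃ t).neg) (fun t => (h₄ t).neg) hk (by linarith)
      (hlim.neg.eventually_const_le (by linarith)) hb).1
    exact absurd hlim.neg (not_tendsto_nhds_of_tendsto_atTop this _)
  · linarith
  · have := (tendsto_atTop_of_fourth_order_lower_bound (m := θ - 1) h₁ h₂ h₃ h₄ hk
      (half_pos h) (hlim.eventually_const_le (by linarith))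
      (hL.eventually_const_le (by linarith))).1
    exact absurd hlim (not_tendsto_nhds_of_tendsto_atTop this _)

lemma ereal_limit_of_fourth_order_eq {v v₁ v₂ v₃ v₄ : ℝ → ℝ} {k K p : ℝ} {θ : EReal}
    (h₁ : ∀ t, HasDerivAt v (v₁ t) t) (h₂ : ∀ t, HasDerivAt v₁ (v₂ t) t)
    (h₃ : ∀ t, HasDerivAt v₂ (v₃ t) t) (h₄ : ∀ t, HasDerivAt v₃ (v₄ t) t)
    (hk : 0 < k) (hp : 1 < p) (hpos : ∀ t, 0 < v t)
    (heq : ∀ t, v₄ t - k * v₂ t + K * v t = v t ^ p) (hθ : 0 ≤ θ)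
    (hlim : Tendsto (fun t => (v t : EReal)) atTop (𝓝 θ)) :
    θ = 0 ∨ θ = ((K ^ (p - 1)⁻¹ : ℝ) : EReal) := by
  induction θ with
  | bot => simp at hθ
  | top =>
    rw [EReal.tendsto_coe_nhds_top_iff] at hlim
    exact absurd hlim (not_tendsto_atTop_of_fourth_order_eq h₁ h₂ h₃ h₄ hk hp hpos heq)
  | coe θ =>
    rw [EReal.tendsto_coe] at hlim
    have h := rpow_eq_mul_of_fourth_order_eq_of_tendsto h₁ h₂ h₃ h₄ hk (by linarith) heq hlim
    rcases (EReal.coe_nonneg.1 hθ).eq_or_lt with h0 | h0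
    · left
      rw [← h0, EReal.coe_zero]
    · right
      have hK : θ ^ (p - 1) = K := by
        rw [Real.rpow_sub_one h0.ne', h, mul_div_cancel_right₀ _ h0.ne']
      rw [← hK, Real.rpow_rpow_inv h0.le (by linarith)]

/-- For `n ≥ 5`, if a positive `C⁴` solution `v` of
`v'''' + K₂ v'' + K₀ v = v^((n+4)/(n-4))` tends (in `[0,+∞] ⊆ EReal`) to some
`θ ∈ [0,+∞]` as `t → +∞` or as `t → -∞`, then `θ ∈ {0, K₀^((n-4)/8)}`; in particular
`θ` is finite, so `v` cannot tend to `+∞`. -/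
theorem limit_is_zero_or_l (n : ℕ) (hn : 5 ≤ n) (v : ℝ → ℝ)
    (hreg : ContDiff ℝ 4 v) (hpos : ∀ t : ℝ, 0 < v t)
    (heq : ∀ t : ℝ,
      iteratedDeriv 4 v t + (-(((n:ℝ)^2 - 4*(n:ℝ) + 8) / 2)) * iteratedDeriv 2 v t
        + ((n:ℝ)^2 * ((n:ℝ) - 4)^2 / 16) * v t = v t ^ (((n:ℝ) + 4) / ((n:ℝ) - 4)))
    (θ : EReal) (hθ : 0 ≤ θ)
    (hlim : Filter.Tendsto (fun t => (v t : EReal)) Filter.atTop (nhds θ) ∨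
            Filter.Tendsto (fun t => (v t : EReal)) Filter.atBot (nhds θ)) :
    θ = 0 ∨ θ = ((((n:ℝ)^2 * ((n:ℝ) - 4)^2 / 16) ^ (((n:ℝ) - 4) / 8) : ℝ) : EReal) := by
  have hn' : (5 : ℝ) ≤ n := by exact_mod_cast hn
  have hn4 : 0 < (n : ℝ) - 4 := by linarith
  have hk : 0 < ((n : ℝ) ^ 2 - 4 * n + 8) / 2 := by nlinarith
  have hp : 1 < ((n : ℝ) + 4) / (n - 4) := by
    rw [lt_div_iff₀ hn4]
    linarith
  have hexp : ((n : ℝ) - 4) / 8 = (((n : ℝ) + 4) / (n - 4) - 1)⁻¹ := by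
    rw [div_sub_one hn4.ne', inv_div]
    ring
  rw [hexp]
  have hd : ∀ m : ℕ, m < 4 → ∀ t, HasDerivAt (iteratedDeriv m v) (iteratedDeriv (m + 1) v t) t := by
    intro m hm t
    rw [iteratedDeriv_succ]
    exact (hreg.differentiable_iteratedDeriv m (by exact_mod_cast hm) t).hasDerivAt
  have h₁ : ∀ t, HasDerivAt v (iteratedDeriv 1 v t) t := by
    simpa only [iteratedDeriv_zero] using hd 0 (by norm_num)
  have h₂ := hd 1 (by norm_num)
  have h₃ := hd 2 (by norm_num)
  have h₄ := hd 3 (by norm_num)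
  rcases hlim with hlim | hlim
  · exact ereal_limit_of_fourth_order_eq h₁ h₂ h₃ h₄ hk hp hpos
      (fun t => by rw [← heq t]; ring) hθ hlim
  · have hneg : ∀ {f f' : ℝ → ℝ}, (∀ t, HasDerivAt f (f' t) t) →
        ∀ t, HasDerivAt (fun t => f (-t)) (-f' (-t)) t := fun hf t =>
      ((hf (-t)).comp t (hasDerivAt_neg t)).congr_deriv (by ring)
    refine ereal_limit_of_fourth_order_eq (v := fun t => v (-t))
      (v₂ := fun t => iteratedDeriv 2 v (-t)) (v₄ := fun t => iteratedDeriv 4 v (-t))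
      (hneg h₁) (fun t => ?_) (hneg h₃) (fun t => ?_) hk hp (fun t => hpos _)
      (fun t => by rw [← heq (-t)]; ring) hθ (hlim.comp tendsto_neg_atTop_atBot)
    · exact (hneg h₂ t).neg.congr_deriv (neg_neg _)
    · exact (hneg h₄ t).neg.congr_deriv (neg_neg _)
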